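/- arXiv:2004.12364 — 2 statements merged into one kernel-verified Lean document; each statement's English description precedes it below -/
import Mathlib

section
/- (Delta-method expansion (5.16), eq:delta-method) In the functional random effects model under Assumption D, assume additionally that σ₁² and σ₂² are continuous and strictly positive on [0,1], and that A → ∞, min_{i≤A} n_i → ∞ and A/√N → 0. Then sup_{t∈[0,1]} | √N·( log λ̂(t) − log λ(t) ) − (√N/(N−A))·Σ_{i=1}^A Σ_{j=1}^{n_i} { (η_{1,i,j}(t)² − σ₁²(t))/σ₁²(t) − (η_{2,i,j}(t)² − σ₂²(t))/σ₂²(t) } | → 0 in probability, where λ = σ₁²/σ₂² and λ̂ = σ̂₁²/σ̂₂². -/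
open MeasureTheory ProbabilityTheory Filter Topology

noncomputable section

/-- The unit interval `[0,1]` as a type. -/
abbrev I01 : Type := Set.Icc (0:ℝ) 1

/-- The Banach space `C([0,1])` of continuous real-valued functions with the sup-norm. -/
abbrev CI : Type := C(I01, ℝ)

/-- The combined family of group-effect pairs and individual-effect pairs, used to state
joint independence in the functional random effects model. -/
def effFam {Ω : Type*} (ε1 ε2 : ℕ → Ω → CI) (η1 η2 : ℕ → ℕ → Ω → CI) :
    (ℕ ⊕ ℕ × ℕ) → Ω → CI × CI
  | Sum.inl i => fun ω => (ε1 i ω, ε2 i ω)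
  | Sum.inr p => fun ω => (η1 p.1 p.2 ω, η2 p.1 p.2 ω)

/-- Observation `X_{l,i,j}(t) = μ_l(t) + ε_{l,i}(t) + η_{l,i,j}(t)` evaluated at `t`. -/
noncomputable def Xre {Ω : Type*} (μ : CI) (ε : ℕ → Ω → CI) (η : ℕ → ℕ → Ω → CI)
    (i j : ℕ) (ω : Ω) (t : I01) : ℝ :=
  μ t + ε i ω t + η i j ω t

/-- Group mean `X̄_{l,i,·}(t)` of the `i`-th group with `ni` observations. -/
noncomputable def XbarRe {Ω : Type*} (μ : CI) (ε : ℕ → Ω → CI) (η : ℕ → ℕ → Ω → CI)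
    (ni i : ℕ) (ω : Ω) (t : I01) : ℝ :=
  (ni : ℝ)⁻¹ * ∑ j ∈ Finset.range ni, Xre μ ε η i j ω t

/-- Pooled variance estimator `σ̂²(t) = (N−A)^{-1} Σ_i Σ_j (X_{i,j}(t) − X̄_{i,·}(t))²`. -/
noncomputable def sigmaHatSq {Ω : Type*} (μ : CI) (ε : ℕ → Ω → CI) (η : ℕ → ℕ → Ω → CI)
    (A : ℕ) (n : ℕ → ℕ) (ω : Ω) (t : I01) : ℝ :=
  ((∑ i ∈ Finset.range A, (n i : ℝ)) - (A : ℝ))⁻¹ *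
    ∑ i ∈ Finset.range A, ∑ j ∈ Finset.range (n i),
      (Xre μ ε η i j ω t - XbarRe μ ε η (n i) i ω t) ^ 2


/-- Dyadic chaining, deterministic part. -/
lemma det_chain (g : ℝ → ℝ) (hg : Continuous g) (b p : ℝ) (hb : 0 ≤ b) (hp0 : 0 ≤ p) (hp1 : p < 1)
    (h : ∀ m k : ℕ, k < 2 ^ m →
      |g (((k:ℝ) + 1) / 2 ^ m) - g ((k:ℝ) / 2 ^ m)| ≤ b * p ^ m)
    (t : ℝ) (ht : t ∈ Set.Icc (0:ℝ) 1) : |g t - g 0| ≤ b / (1 - p) := by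
  have key : ∀ m k : ℕ, k ≤ 2 ^ m →
      |g ((k:ℝ) / 2 ^ m) - g 0| ≤ b * ∑ j ∈ Finset.range (m + 1), p ^ j := by
    intro m
    induction m with
    | zero =>
      intro k hk
      have := h 0 0 (by norm_num)
      interval_cases k
      · simpa using hb
      · simpa using this
    | succ m ih =>
      intro k hk
      rw [Finset.sum_range_succ, mul_add]
      rcases Nat.even_or_odd' k with ⟨l, rfl | rfl⟩
      · have h1 := ih l (by rw [pow_succ] at hk; omega)
        have e : ((2 * l : ℕ) : ℝ) / 2 ^ (m + 1) = (l:ℝ) / 2 ^ m := by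
          push_cast; rw [pow_succ]; field_simp
        rw [e]
        have : 0 ≤ b * p ^ (m + 1) := by positivity
        linarith
      · have h1 := ih l (by rw [pow_succ] at hk; omega)
        have h2 := h (m + 1) (2 * l) (by omega)
        have e : ((2 * l : ℕ) : ℝ) / 2 ^ (m + 1) = (l:ℝ) / 2 ^ m := by
          push_cast; rw [pow_succ]; field_simp
        rw [e] at h2
        have e2 : ((2 * l + 1 : ℕ) : ℝ) = ((2 * l : ℕ) : ℝ) + 1 := by push_cast; ring
        rw [e2]
        calc _ ≤ _ := abs_sub_le _ (g ((l:ℝ) / 2 ^ m)) _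
          _ ≤ _ := by linarith
  have hsum : ∀ m : ℕ, ∑ j ∈ Finset.range (m + 1), p ^ j ≤ 1 / (1 - p) := by
    intro m
    have h1 : 0 < 1 - p := by linarith
    rw [le_div_iff₀ h1, geom_sum_mul_neg]
    have := pow_nonneg hp0 (m + 1)
    linarith
  have hlim : Tendsto (fun m : ℕ => ((⌊t * 2 ^ m⌋₊ : ℕ) : ℝ) / 2 ^ m) atTop (𝓝 t) := by
    have h1 := tendsto_nat_floor_mul_div_atTop (R := ℝ) ht.1
    exact h1.comp (tendsto_pow_atTop_atTop_of_one_lt (one_lt_two))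
  have hlim2 := ((hg.tendsto t).comp hlim)
  have hlim3 := (hlim2.sub_const (g 0)).abs
  refine le_of_tendsto hlim3 (Eventually.of_forall fun m => ?_)
  have h1 := key m ⌊t * 2 ^ m⌋₊ (by
    have : t * 2 ^ m ≤ ((2 ^ m : ℕ) : ℝ) := by
      push_cast
      have : (0:ℝ) < 2 ^ m := by positivity
      nlinarith [ht.2]
    exact Nat.floor_le_of_le this)
  refine h1.trans ?_
  rw [div_eq_mul_one_div]
  exact mul_le_mul_of_nonneg_left (hsum m) hb

/-- the point of the unit interval closest to `x` -/
def ptI (x : ℝ) : I01 := Set.projIcc 0 1 zero_le_one x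

lemma exists_ratio (th : ℝ) (hth : 1/4 < th) :
    ∃ p : ℝ, 0 < p ∧ p < 1 ∧ ∀ m : ℕ, (2:ℝ) ^ m * ((1:ℝ) / 2 ^ m) ^ (4 * th) = p ^ (8 * m) := by
  refine ⟨((2:ℝ) ^ (1 - 4 * th)) ^ ((1:ℝ)/8), by positivity, ?_, ?_⟩
  · apply Real.rpow_lt_one (by positivity) _ (by norm_num)
    exact Real.rpow_lt_one_of_one_lt_of_neg (by norm_num) (by linarith)
  · intro m
    rw [pow_mul, ← Real.rpow_natCast (((2:ℝ) ^ (1 - 4 * th)) ^ ((1:ℝ)/8)) 8,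
      ← Real.rpow_mul (by positivity)]
    norm_num
    rw [← Real.rpow_natCast ((2:ℝ) ^ (1 - 4 * th)) m, ← Real.rpow_mul (by norm_num),
      ← Real.rpow_natCast 2 m, ← Real.rpow_neg (by norm_num), ← Real.rpow_mul (by norm_num),
      ← Real.rpow_add (by norm_num)]
    congr 1
    ring

/-- Kolmogorov-type maximal inequality. -/
lemma kolm (th : ℝ) (hth : 1/4 < th) : ∃ K : ℝ, 0 ≤ K ∧ ∀ {Ω : Type*} [MeasurableSpace Ω]
    (P : Measure Ω) (Z : Ω → CI) (_ : ∀ t, Measurable fun ω => Z ω t) (C : ℝ) (_ : 0 ≤ C)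
    (_ : ∀ t, ∫⁻ ω, ENNReal.ofReal ((Z ω t) ^ 4) ∂P ≤ ENNReal.ofReal C)
    (_ : ∀ s t : I01, ∫⁻ ω, ENNReal.ofReal ((Z ω s - Z ω t) ^ 4) ∂P
      ≤ ENNReal.ofReal (C * |(s:ℝ) - t| ^ (4 * th))),
    ∃ W : Ω → ENNReal, Measurable W ∧ ∫⁻ ω, W ω ∂P ≤ ENNReal.ofReal (K * C) ∧
      ∀ ω t, ENNReal.ofReal ((Z ω t) ^ 4) ≤ W ω := by
  obtain ⟨p, hp0, hp1, hp⟩ := exists_ratio th hth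
  have hp4 : p ^ 4 < 1 := pow_lt_one₀ hp0.le hp1 (by norm_num)
  have h1p : 0 < 1 - p := by linarith
  set c : ℝ := 8 * (1 / (1 - p)) ^ 4 with hc
  have hc0 : 0 ≤ c := by positivity
  refine ⟨8 + c * (1 - p ^ 4)⁻¹, by
    have : 0 ≤ (1 - p ^ 4)⁻¹ := inv_nonneg.2 (by linarith)
    positivity, ?_⟩
  intro Ω _ P Z hZ C hC h0 hinc
  set D : ℕ → ℕ → Ω → ENNReal := fun m k ω =>
    ENNReal.ofReal ((Z ω (ptI (((k:ℝ) + 1) / 2 ^ m)) - Z ω (ptI ((k:ℝ) / 2 ^ m))) ^ 4) with hD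
  have hDm : ∀ m k, Measurable (D m k) := fun m k =>
    (((hZ _).sub (hZ _)).pow_const 4).ennreal_ofReal
  set B : Ω → ENNReal := fun ω =>
    ∑' m : ℕ, ENNReal.ofReal ((p ^ (4 * m))⁻¹) * ∑ k ∈ Finset.range (2 ^ m), D m k ω with hB
  have hBm : Measurable B := Measurable.tsum fun m =>
    (Finset.measurable_sum _ fun k _ => hDm m k).const_mul _
  have hDint : ∀ m k, k < 2 ^ m → ∫⁻ ω, D m k ω ∂P
      ≤ ENNReal.ofReal (C * ((1:ℝ) / 2 ^ m) ^ (4 * th)) := by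
    intro m k hk
    have h2 : (0:ℝ) < 2 ^ m := by positivity
    have hk' : (k:ℝ) + 1 ≤ 2 ^ m := by exact_mod_cast hk
    have e1 : ((ptI (((k:ℝ) + 1) / 2 ^ m) : I01) : ℝ) = ((k:ℝ) + 1) / 2 ^ m := by
      rw [ptI, Set.projIcc_of_mem zero_le_one (x := ((k:ℝ) + 1) / 2 ^ m)
        ⟨by positivity, by rw [div_le_one h2]; exact hk'⟩]
    have e2 : ((ptI ((k:ℝ) / 2 ^ m) : I01) : ℝ) = (k:ℝ) / 2 ^ m := by
      rw [ptI, Set.projIcc_of_mem zero_le_one (x := (k:ℝ) / 2 ^ m)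
        ⟨by positivity, by rw [div_le_one h2]; linarith⟩]
    refine (hinc _ _).trans ?_
    rw [e1, e2, ← sub_div, add_sub_cancel_left, abs_of_nonneg (by positivity)]
  have hBint : ∫⁻ ω, B ω ∂P ≤ ENNReal.ofReal (C * (1 - p ^ 4)⁻¹) := by
    rw [hB, lintegral_tsum (fun m => ((Finset.measurable_sum _ fun k _ =>
      hDm m k).const_mul _).aemeasurable)]
    have hs : Summable fun m : ℕ => C * (p ^ 4) ^ m :=
      (summable_geometric_of_lt_one (by positivity) hp4).mul_left C
    rw [← tsum_geometric_of_lt_one (by positivity) hp4, ← tsum_mul_left,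
      ENNReal.ofReal_tsum_of_nonneg (fun m => by positivity) hs]
    refine ENNReal.tsum_le_tsum fun m => ?_
    rw [lintegral_const_mul _ (Finset.measurable_sum _ fun k _ => hDm m k),
      lintegral_finsetSum _ fun k _ => hDm m k]
    calc _ ≤ ENNReal.ofReal ((p ^ (4 * m))⁻¹) * ∑ k ∈ Finset.range (2 ^ m),
          ENNReal.ofReal (C * ((1:ℝ) / 2 ^ m) ^ (4 * th)) := by
          gcongr with k hk
          exact hDint m k (Finset.mem_range.1 hk)
      _ = ENNReal.ofReal ((p ^ (4 * m))⁻¹ * (2 ^ m * (C * ((1:ℝ) / 2 ^ m) ^ (4 * th)))) := by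
          rw [Finset.sum_const, Finset.card_range, nsmul_eq_mul,
            ENNReal.ofReal_mul (p := (p ^ (4 * m))⁻¹) (by positivity),
            ENNReal.ofReal_mul (p := (2:ℝ) ^ m) (by positivity)]
          congr 2
          rw [ENNReal.ofReal_pow (by norm_num)]; simp
      _ = _ := by
          congr 1
          have := hp m
          rw [show (p ^ (4 * m))⁻¹ * (2 ^ m * (C * ((1:ℝ) / 2 ^ m) ^ (4 * th)))
            = (p ^ (4 * m))⁻¹ * C * (2 ^ m * ((1:ℝ) / 2 ^ m) ^ (4 * th)) by ring, this,
            ← pow_mul, show 8 * m = 4 * m + 4 * m by ring, pow_add]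
          field_simp
  refine ⟨fun ω => 8 * ENNReal.ofReal ((Z ω (ptI 0)) ^ 4) + ENNReal.ofReal c * B ω, ?_, ?_, ?_⟩
  · exact (((hZ _).pow_const 4).ennreal_ofReal.const_mul _).add (hBm.const_mul _)
  · rw [lintegral_add_right _ (hBm.const_mul _), lintegral_const_mul _ hBm,
      lintegral_const_mul _ ((hZ _).pow_const 4).ennreal_ofReal]
    calc _ ≤ 8 * ENNReal.ofReal C + ENNReal.ofReal c * ENNReal.ofReal (C * (1 - p ^ 4)⁻¹) := by
          gcongr
          exact h0 _
      _ = _ := by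
          have : 0 ≤ (1 - p ^ 4)⁻¹ := inv_nonneg.2 (by linarith)
          rw [← ENNReal.ofReal_mul hc0, show (8:ENNReal) = ENNReal.ofReal 8 by simp,
            ← ENNReal.ofReal_mul (by norm_num), ← ENNReal.ofReal_add (by positivity) (by positivity)]
          congr 1; ring
  · intro ω t
    rcases eq_or_ne (B ω) ⊤ with hT | hT
    · have hcpos : 0 < c := by positivity
      simp [hT, ENNReal.mul_top, hcpos]
    · set b : ℝ := (B ω).toReal ^ ((1:ℝ)/4) with hb
      have hb4 : b ^ 4 = (B ω).toReal := by
        rw [hb, ← Real.rpow_natCast, ← Real.rpow_mul ENNReal.toReal_nonneg]; norm_num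
      have hb0 : 0 ≤ b := by positivity
      have hch := det_chain (fun x => Z ω (ptI x)) ((Z ω).continuous.comp (continuous_projIcc (h := zero_le_one))) b p
        hb0 hp0.le hp1 (by
          intro m k hk
          have h1 : ENNReal.ofReal ((p ^ (4 * m))⁻¹) * D m k ω ≤ B ω := by
            refine le_trans ?_ (ENNReal.le_tsum m)
            gcongr
            exact Finset.single_le_sum (f := fun k => D m k ω) (fun _ _ => zero_le)
              (Finset.mem_range.2 hk)
          rw [hD, ← ENNReal.ofReal_mul (by positivity), ENNReal.ofReal_le_iff_le_toReal hT,
            ← hb4, inv_mul_le_iff₀ (by positivity)] at h1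
          have h2 : (|Z ω (ptI (((k:ℝ) + 1) / 2 ^ m)) - Z ω (ptI ((k:ℝ) / 2 ^ m))|) ^ 4
              ≤ (b * p ^ m) ^ 4 := by
            rw [pow_abs, abs_of_nonneg (by positivity)]
            refine h1.trans (le_of_eq ?_)
            rw [mul_pow, ← pow_mul]; ring
          exact le_of_pow_le_pow_left₀ (by norm_num) (by positivity) h2) t t.2
      have et : ptI (t:ℝ) = t := Set.projIcc_val _ t
      simp only [et] at hch
      beta_reduce
      rw [show (8:ENNReal) = ENNReal.ofReal 8 by simp, ← ENNReal.ofReal_toReal hT,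
        ← ENNReal.ofReal_mul hc0, ← ENNReal.ofReal_mul (by norm_num),
        ← ENNReal.ofReal_add (by positivity) (by positivity), ← hb4]
      apply ENNReal.ofReal_le_ofReal
      have h4 : (Z ω t - Z ω (ptI 0)) ^ 4 ≤ (b / (1 - p)) ^ 4 := by
        have := pow_le_pow_left₀ (abs_nonneg _) hch 4
        rwa [pow_abs, abs_of_nonneg (by positivity)] at this
      have h5 : ∀ x y : ℝ, x ^ 4 ≤ 8 * y ^ 4 + 8 * (x - y) ^ 4 := by
        intro x y
        have a1 : x ^ 2 ≤ 2 * (y ^ 2 + (x - y) ^ 2) := by nlinarith [sq_nonneg (x - 2 * y)]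
        have a2 : x ^ 4 ≤ (2 * (y ^ 2 + (x - y) ^ 2)) ^ 2 := by
          have := pow_le_pow_left₀ (sq_nonneg x) a1 2
          rwa [← pow_mul] at this
        nlinarith [sq_nonneg (y ^ 2 - (x - y) ^ 2)]
      refine (h5 _ (Z ω (ptI 0))).trans ?_
      have : c * b ^ 4 = 8 * (b / (1 - p)) ^ 4 := by rw [hc]; ring
      rw [this]; linarith

lemma iadd {Ω : Type*} [MeasurableSpace Ω] {P : Measure Ω} {f g : Ω → ℝ} (hf : Integrable f P)
    (hg : Integrable g P) : Integrable (fun x => f x + g x) P := hf.add hg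

lemma isub {Ω : Type*} [MeasurableSpace Ω] {P : Measure Ω} {f g : Ω → ℝ} (hf : Integrable f P)
    (hg : Integrable g P) : Integrable (fun x => f x - g x) P := hf.sub hg

lemma four_add (x y : ℝ) : (x + y) ^ 4 ≤ 8 * x ^ 4 + 8 * y ^ 4 := by
  have a1 : (x + y) ^ 2 ≤ 2 * (x ^ 2 + y ^ 2) := by nlinarith [sq_nonneg (x - y)]
  have a2 : (x + y) ^ 4 ≤ (2 * (x ^ 2 + y ^ 2)) ^ 2 := by
    have := pow_le_pow_left₀ (sq_nonneg (x + y)) a1 2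
    rwa [← pow_mul] at this
  nlinarith [sq_nonneg (x ^ 2 - y ^ 2)]

lemma four_sub (x y : ℝ) : (x - y) ^ 4 ≤ 8 * x ^ 4 + 8 * y ^ 4 := by
  have := four_add x (-y)
  rw [← sub_eq_add_neg] at this
  refine this.trans (le_of_eq ?_); ring

lemma int_pow {Ω : Type*} [MeasurableSpace Ω] {P : Measure Ω} [IsProbabilityMeasure P] {X : Ω → ℝ}
    (hX : Measurable X) (h4 : Integrable (fun ω => X ω ^ 4) P) (k : ℕ) (hk : k ≤ 4) :
    Integrable (fun ω => X ω ^ k) P := by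
  refine Integrable.mono' (g := fun ω => 1 + X ω ^ 4) ((integrable_const _).add h4)
    (hX.pow_const k).aestronglyMeasurable (ae_of_all _ fun ω => ?_)
  rw [Real.norm_eq_abs, abs_pow]
  have e : X ω ^ 4 = |X ω| ^ 4 := by rw [pow_abs, abs_of_nonneg (by positivity)]
  rw [e]
  rcases le_total |X ω| 1 with h | h
  · have := pow_le_one₀ (n := k) (abs_nonneg _) h
    have : 0 ≤ |X ω| ^ 4 := by positivity
    linarith
  · have := pow_le_pow_right₀ h hk
    linarith

lemma int_add4 {Ω : Type*} [MeasurableSpace Ω] {P : Measure Ω} {X Y : Ω → ℝ}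
    (hX : Measurable X) (hY : Measurable Y) (h4 : Integrable (fun ω => X ω ^ 4) P)
    (h4' : Integrable (fun ω => Y ω ^ 4) P) :
    Integrable (fun ω => (X ω + Y ω) ^ 4) P := by
  refine Integrable.mono' ((h4.const_mul 8).add (h4'.const_mul 8))
    ((hX.add hY).pow_const 4).aestronglyMeasurable (ae_of_all _ fun ω => ?_)
  rw [Real.norm_eq_abs, abs_of_nonneg (by positivity)]
  exact four_add _ _

lemma int_sub4 {Ω : Type*} [MeasurableSpace Ω] {P : Measure Ω} {X Y : Ω → ℝ}
    (hX : Measurable X) (hY : Measurable Y) (h4 : Integrable (fun ω => X ω ^ 4) P)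
    (h4' : Integrable (fun ω => Y ω ^ 4) P) :
    Integrable (fun ω => (X ω - Y ω) ^ 4) P := by
  refine Integrable.mono' ((h4.const_mul 8).add (h4'.const_mul 8))
    ((hX.sub hY).pow_const 4).aestronglyMeasurable (ae_of_all _ fun ω => ?_)
  rw [Real.norm_eq_abs, abs_of_nonneg (by positivity)]
  exact four_sub _ _

lemma sq_int_le {Ω : Type*} [MeasurableSpace Ω] {P : Measure Ω} [IsProbabilityMeasure P] {X : Ω → ℝ}
    (h2 : Integrable X P) (h4 : Integrable (fun ω => X ω ^ 2) P) :
    (∫ ω, X ω ∂P) ^ 2 ≤ ∫ ω, X ω ^ 2 ∂P := by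
  set a := ∫ ω, X ω ∂P with ha
  have h0 : 0 ≤ ∫ ω, (X ω - a) ^ 2 ∂P := integral_nonneg fun ω => sq_nonneg _
  have e : ∫ ω, (X ω - a) ^ 2 ∂P = ∫ ω, X ω ^ 2 ∂P - 2 * a * a + a ^ 2 := by
    have : (fun ω => (X ω - a) ^ 2) = fun ω => X ω ^ 2 - 2 * a * X ω + a ^ 2 := by
      ext ω; ring
    rw [this, integral_add (isub h4 (h2.const_mul _)) (integrable_const _),
      integral_sub h4 (h2.const_mul _), integral_const_mul]
    simp [ha]
  rw [e] at h0
  nlinarith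

/-- Fourth moment of a sum of independent centered variables. -/
lemma fourth {Ω ι : Type*} [DecidableEq ι] [MeasurableSpace Ω] {P : Measure Ω}
    [IsProbabilityMeasure P] (X : ι → Ω → ℝ) (hX : ∀ i, Measurable (X i))
    (hind : iIndepFun X P) (h4 : ∀ i, Integrable (fun ω => X i ω ^ 4) P)
    (h0 : ∀ i, ∫ ω, X i ω ∂P = 0) (m : ℝ) (hm : ∀ i, ∫ ω, X i ω ^ 4 ∂P ≤ m) (F : Finset ι) :
    Integrable (fun ω => (∑ i ∈ F, X i ω) ^ 4) P ∧
      ∫ ω, (∑ i ∈ F, X i ω) ^ 4 ∂P ≤ 3 * (F.card : ℝ) ^ 2 * m := by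
  suffices H : Integrable (fun ω => (∑ i ∈ F, X i ω) ^ 4) P ∧ ∫ ω, (∑ i ∈ F, X i ω) ∂P = 0 ∧
      ∫ ω, (∑ i ∈ F, X i ω) ^ 2 ∂P ≤ F.card * √m ∧
      ∫ ω, (∑ i ∈ F, X i ω) ^ 4 ∂P ≤ 3 * (F.card : ℝ) ^ 2 * m from ⟨H.1, H.2.2.2⟩
  induction F using Finset.induction_on with
  | empty => simp
  | insert a F ha ih =>
    obtain ⟨i4, i1, i2, i3⟩ := ih
    have hm0 : 0 ≤ m := (integral_nonneg fun ω => by positivity).trans (hm a)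
    set S : Ω → ℝ := fun ω => ∑ i ∈ F, X i ω with hS
    have hSm : Measurable S := Finset.measurable_sum _ fun i _ => hX i
    have i4 : Integrable (fun ω => S ω ^ 4) P := i4
    have hSX : IndepFun S (X a) P := by
      have := hind.indepFun_finsetSum_of_notMem hX ha
      convert this using 1
      ext ω; simp [hS]
    have e : ∀ ω, ∑ i ∈ insert a F, X i ω = S ω + X a ω := by
      intro ω; rw [Finset.sum_insert ha, add_comm]
    simp only [e]
    have ps := fun k hk => int_pow hSm i4 k hk
    have px := fun k hk => int_pow (hX a) (h4 a) k hk
    have hprod : ∀ k l : ℕ, IndepFun (fun ω => S ω ^ k) (fun ω => X a ω ^ l) P := fun k l =>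
      hSX.comp (φ := fun x : ℝ => x ^ k) (ψ := fun x : ℝ => x ^ l)
        (measurable_id.pow_const k) (measurable_id.pow_const l)
    have iprod : ∀ k l : ℕ, k ≤ 4 → l ≤ 4 → Integrable (fun ω => S ω ^ k * X a ω ^ l) P :=
      fun k l hk hl => (hprod k l).integrable_mul (ps k hk) (px l hl)
    have eprod : ∀ k l : ℕ, ∫ ω, S ω ^ k * X a ω ^ l ∂P
        = (∫ ω, S ω ^ k ∂P) * ∫ ω, X a ω ^ l ∂P := fun k l =>
      (hprod k l).integral_fun_mul_eq_mul_integral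
        (hSm.pow_const k).aestronglyMeasurable ((hX a).pow_const l).aestronglyMeasurable
    have hx2 : ∫ ω, X a ω ^ 2 ∂P ≤ √m := by
      apply Real.le_sqrt_of_sq_le
      refine (sq_int_le (px 2 (by norm_num)) ?_).trans ?_
      · simpa only [← pow_mul] using h4 a
      · simpa only [← pow_mul] using hm a
    have hs1 : Integrable S P := by simpa using ps 1 (by norm_num)
    have hx1 : Integrable (X a) P := by simpa using px 1 (by norm_num)
    have hs2' : 0 ≤ ∫ ω, S ω ^ 2 ∂P := integral_nonneg fun ω => by positivity
    have hx2' : 0 ≤ ∫ ω, X a ω ^ 2 ∂P := integral_nonneg fun ω => by positivity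
    rw [Finset.card_insert_of_notMem ha]
    push_cast
    refine ⟨int_add4 hSm (hX a) i4 (h4 a), ?_, ?_, ?_⟩
    · rw [integral_add hs1 hx1, h0 a]; simpa using i1
    · have e2 : ∫ ω, (S ω + X a ω) ^ 2 ∂P = ∫ ω, S ω ^ 2 ∂P + ∫ ω, X a ω ^ 2 ∂P := by
        have : (fun ω => (S ω + X a ω) ^ 2)
            = fun ω => S ω ^ 2 + 2 * (S ω ^ 1 * X a ω ^ 1) + X a ω ^ 2 := by ext ω; ring
        rw [this, integral_add (iadd (ps 2 (by norm_num))
            ((iprod 1 1 (by norm_num) (by norm_num)).const_mul 2)) (px 2 (by norm_num)),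
          integral_add (ps 2 (by norm_num)) ((iprod 1 1 (by norm_num) (by norm_num)).const_mul 2),
          integral_const_mul, eprod]
        simp [h0 a]
      rw [e2]; linarith
    · have e4 : ∫ ω, (S ω + X a ω) ^ 4 ∂P = ∫ ω, S ω ^ 4 ∂P
          + 6 * ((∫ ω, S ω ^ 2 ∂P) * ∫ ω, X a ω ^ 2 ∂P) + ∫ ω, X a ω ^ 4 ∂P := by
        have : (fun ω => (S ω + X a ω) ^ 4)
            = fun ω => S ω ^ 4 + 4 * (S ω ^ 3 * X a ω ^ 1) + 6 * (S ω ^ 2 * X a ω ^ 2)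
              + 4 * (S ω ^ 1 * X a ω ^ 3) + X a ω ^ 4 := by ext ω; ring
        have j1 := (iprod 3 1 (by norm_num) (by norm_num)).const_mul 4
        have j2 := (iprod 2 2 (by norm_num) (by norm_num)).const_mul 6
        have j3 := (iprod 1 3 (by norm_num) (by norm_num)).const_mul 4
        rw [this, integral_add (iadd (iadd (iadd i4 j1) j2) j3) (h4 a),
          integral_add (iadd (iadd i4 j1) j2) j3, integral_add (iadd i4 j1) j2, integral_add i4 j1,
          integral_const_mul, integral_const_mul, integral_const_mul, eprod, eprod, eprod]
        have i1' : ∫ ω, S ω ∂P = 0 := i1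
        simp [h0 a, i1']
      have h6 : (∫ ω, S ω ^ 2 ∂P) * ∫ ω, X a ω ^ 2 ∂P ≤ (F.card * √m) * √m :=
        mul_le_mul i2 hx2 hx2' (by positivity)
      rw [mul_assoc, Real.mul_self_sqrt hm0] at h6
      rw [e4]
      have := hm a
      nlinarith

/-- Maximal inequality for sums of independent centered processes. -/
lemma supsum (th : ℝ) (hth : 1/4 < th) {Ω ι : Type*} [DecidableEq ι] [MeasurableSpace Ω]
    (P : Measure Ω) [IsProbabilityMeasure P] (X : ι → Ω → CI)
    (hX : ∀ i t, Measurable fun ω => X i ω t)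
    (hind : ∀ t, iIndepFun (fun i ω => X i ω t) P)
    (hind2 : ∀ s t, iIndepFun (fun i ω => X i ω s - X i ω t) P)
    (h0 : ∀ i t, ∫ ω, X i ω t ∂P = 0)
    (h4 : ∀ i t, Integrable (fun ω => X i ω t ^ 4) P)
    (C : ℝ) (hC : 0 ≤ C) (hm : ∀ i t, ∫ ω, X i ω t ^ 4 ∂P ≤ C)
    (hm2 : ∀ i (s t : I01), ∫ ω, (X i ω s - X i ω t) ^ 4 ∂P ≤ C * |(s:ℝ) - t| ^ (4 * th)) :
    ∃ K : ℝ, 0 ≤ K ∧ ∀ F : Finset ι, ∃ W : Ω → ENNReal, Measurable W ∧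
      ∫⁻ ω, W ω ∂P ≤ ENNReal.ofReal (K * (F.card : ℝ) ^ 2) ∧
      ∀ ω t, ENNReal.ofReal ((∑ i ∈ F, X i ω t) ^ 4) ≤ W ω := by
  obtain ⟨K, hK, H⟩ := kolm th hth
  refine ⟨K * (3 * C), by positivity, fun F => ?_⟩
  obtain ⟨W, hW, hW1, hW2⟩ := H P (fun ω => ∑ i ∈ F, X i ω)
    (fun t => by simpa using Finset.measurable_sum _ fun i _ => hX i t)
    (3 * (F.card : ℝ) ^ 2 * C) (by positivity)
    (fun t => by
      have := fourth (fun i ω => X i ω t) (fun i => hX i t) (hind t) (fun i => h4 i t)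
        (fun i => h0 i t) C (fun i => hm i t) F
      simp only [ContinuousMap.coe_sum, Finset.sum_apply]
      rw [← ofReal_integral_eq_lintegral_ofReal this.1 (ae_of_all _ fun ω => by positivity)]
      exact ENNReal.ofReal_le_ofReal this.2)
    (fun s t => by
      have hi : ∀ i t, Integrable (fun ω => X i ω t) P := fun i t => by
        simpa using int_pow (hX i t) (h4 i t) 1 (by norm_num)
      have := fourth (fun i ω => X i ω s - X i ω t) (fun i => (hX i s).sub (hX i t)) (hind2 s t)
        (fun i => int_sub4 (hX i s) (hX i t) (h4 i s) (h4 i t))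
        (fun i => by rw [integral_sub (hi i s) (hi i t), h0, h0, sub_zero]) _
        (fun i => hm2 i s t) F
      simp only [ContinuousMap.coe_sum, Finset.sum_apply, ← Finset.sum_sub_distrib]
      rw [← ofReal_integral_eq_lintegral_ofReal this.1 (ae_of_all _ fun ω => by positivity)]
      exact ENNReal.ofReal_le_ofReal (this.2.trans (le_of_eq (by ring))))
  refine ⟨W, hW, hW1.trans (le_of_eq (by congr 1; ring)), fun ω t => ?_⟩
  simpa using hW2 ω t

lemma log_quad (u : ℝ) (hu : u ^ 2 ≤ 1/4) : |Real.log (1 + u) - u| ≤ 2 * u ^ 2 := by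
  have h1 : -(1/2) ≤ u := by nlinarith
  have hpos : 0 < 1 + u := by linarith
  have a := Real.log_le_sub_one_of_pos hpos
  have b := Real.one_sub_inv_le_log_of_pos hpos
  have e : 1 - (1 + u)⁻¹ = u - u ^ 2 / (1 + u) := by field_simp; ring
  have h2 : u ^ 2 / (1 + u) ≤ 2 * u ^ 2 := by
    rw [div_le_iff₀ hpos]; nlinarith [sq_nonneg u]
  rw [abs_le]
  constructor <;> nlinarith [sq_nonneg u]

set_option maxHeartbeats 1000000 in
lemma det_delta (c del : ℝ) (hc : 0 < c) (hdel : 0 < del) : ∃ d : ℝ, 0 < d ∧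
    ∀ N A S R v : ℝ, 1 ≤ N → 0 ≤ A → A ≤ d * √N → c ≤ v → 0 ≤ R → R ≤ d * √N →
      S ^ 4 ≤ d ^ 4 * N ^ 3 →
      0 < (N - A)⁻¹ * (S + N * v - R) ∧
      |√N * (Real.log ((N - A)⁻¹ * (S + N * v - R)) - Real.log v) - √N / (N - A) * (S / v)|
        ≤ del := by
  set G : ℝ := 12 * (2 / c ^ 2 + 1) with hG
  set H : ℝ := 2 * (1 + 1 / c) with hH
  have hGp : 0 < G := by positivity
  have hHp : 0 < H := by positivity
  obtain ⟨d, hd0, hd1, hd2, hd3, hd4⟩ : ∃ d : ℝ, 0 < d ∧ d ≤ 1/2 ∧ d ≤ 1 / (2 * G) ∧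
      d ≤ del / (2 * G) ∧ d ≤ del / (2 * H) :=
    ⟨min (1/2) (min (1 / (2 * G)) (min (del / (2 * G)) (del / (2 * H)))),
      by positivity, by simp, by simp, by simp, by simp⟩
  rw [le_div_iff₀ (by positivity)] at hd2 hd3 hd4
  refine ⟨d, hd0, ?_⟩
  intro N A S R v hN hA hAd hv hR hRd hS
  set s := √N with hs
  have hsN : s ^ 2 = N := Real.sq_sqrt (by linarith)
  have hs1 : 1 ≤ s := Real.one_le_sqrt.2 hN
  have hs0 : 0 < s := by linarith
  have hv0 : 0 < v := by linarith
  have hNA : s ^ 2 / 2 ≤ N - A := by nlinarith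
  have hNA0 : 0 < N - A := lt_of_lt_of_le (by positivity) hNA
  have hS2 : S ^ 2 ≤ d ^ 2 * s ^ 3 := by
    have : (S ^ 2) ^ 2 ≤ (d ^ 2 * s ^ 3) ^ 2 := by
      rw [← hsN] at hS
      calc (S ^ 2) ^ 2 = S ^ 4 := by ring
        _ ≤ _ := hS
        _ = _ := by ring
    exact le_of_sq_le_sq this (by positivity)
  set x := S / ((N - A) * v) with hx
  set y := A / (N - A) with hy
  set r := R / ((N - A) * v) with hr
  have hden : s ^ 2 / 2 * c ≤ (N - A) * v := mul_le_mul hNA hv hc.le hNA0.le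
  have hx2 : x ^ 2 ≤ 4 * d ^ 2 / (c ^ 2 * s) := by
    rw [hx, div_pow]
    calc S ^ 2 / ((N - A) * v) ^ 2 ≤ (d ^ 2 * s ^ 3) / (s ^ 2 / 2 * c) ^ 2 := by gcongr
      _ = _ := by field_simp; ring
  have hy0 : 0 ≤ y := by positivity
  have hr0 : 0 ≤ r := by positivity
  have hy1 : y ≤ 2 * d / s := by
    calc y ≤ (d * s) / (s ^ 2 / 2) := by rw [hy]; gcongr
      _ = _ := by field_simp
  have hr1 : r ≤ 2 * d / (c * s) := by
    calc r ≤ (d * s) / (s ^ 2 / 2 * c) := by rw [hr]; gcongr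
      _ = _ := by field_simp
  have hsi : 1 / s ^ 2 ≤ 1 / s := by
    apply one_div_le_one_div_of_le hs0; nlinarith
  have hy2 : y ^ 2 ≤ 4 * d ^ 2 * (1 / s) := by
    calc y ^ 2 ≤ (2 * d / s) ^ 2 := by gcongr
      _ = 4 * d ^ 2 * (1 / s ^ 2) := by field_simp; ring
      _ ≤ _ := by gcongr
  have hr2 : r ^ 2 ≤ 4 * d ^ 2 / c ^ 2 * (1 / s) := by
    calc r ^ 2 ≤ (2 * d / (c * s)) ^ 2 := by gcongr
      _ = 4 * d ^ 2 / c ^ 2 * (1 / s ^ 2) := by field_simp; ring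
      _ ≤ _ := by gcongr
  set u := x + y - r with hu
  have hu2 : u ^ 2 ≤ G * d ^ 2 / s := by
    have : u ^ 2 ≤ 3 * (x ^ 2 + y ^ 2 + r ^ 2) := by
      nlinarith [sq_nonneg (x - y), sq_nonneg (x + r), sq_nonneg (y + r)]
    have e : G * d ^ 2 / s = 3 * (4 * d ^ 2 / (c ^ 2 * s) + 4 * d ^ 2 * (1 / s)
      + 4 * d ^ 2 / c ^ 2 * (1 / s)) := by rw [hG]; field_simp; ring
    rw [e]; linarith
  have hd5 : d ^ 2 ≤ d * (1/2) := by rw [sq]; gcongr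
  have hd6 := mul_le_mul_of_nonneg_left hd5 hGp.le
  clear_value G H
  have hGd : G * d ^ 2 ≤ 1/4 := by linarith
  have hGd2 : 2 * (G * d ^ 2) ≤ del / 2 := by linarith
  have hHd : H * d ≤ del / 2 := by linarith
  have hu3 : s * u ^ 2 ≤ G * d ^ 2 := by
    rw [le_div_iff₀ hs0] at hu2; linarith
  have hu4 : u ^ 2 ≤ 1/4 := by
    have := le_mul_of_one_le_left (sq_nonneg u) hs1
    linarith
  have hupos : 0 < 1 + u := by
    have := abs_le_of_sq_le_sq (show u ^ 2 ≤ (1/2) ^ 2 by linarith) (by norm_num)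
    linarith [(abs_le.1 this).1]
  have esig : (N - A)⁻¹ * (S + N * v - R) = v * (1 + u) := by
    rw [hu, hx, hy, hr]; field_simp; ring
  rw [esig]
  refine ⟨by positivity, ?_⟩
  rw [Real.log_mul hv0.ne' hupos.ne']
  have e2 : s * (Real.log v + Real.log (1 + u) - Real.log v) - s / (N - A) * (S / v)
      = s * (Real.log (1 + u) - u) + s * (y - r) := by
    have : s / (N - A) * (S / v) = s * x := by rw [hx]; field_simp
    rw [this, hu]; ring
  rw [e2]
  have hl := log_quad u hu4
  have b1 : |s * (Real.log (1 + u) - u)| ≤ del / 2 := by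
    rw [abs_mul, abs_of_pos hs0]
    calc _ ≤ s * (2 * u ^ 2) := by gcongr
      _ ≤ _ := by linarith
  have b2 : |s * (y - r)| ≤ del / 2 := by
    rw [abs_mul, abs_of_pos hs0]
    have : |y - r| ≤ y + r := by rw [abs_le]; constructor <;> linarith
    calc _ ≤ s * (2 * d / s + 2 * d / (c * s)) := by gcongr; linarith
      _ = H * d := by rw [hH]; field_simp
      _ ≤ _ := hHd
  exact (abs_add_le _ _).trans (by linarith)

lemma center4 {Ω : Type*} [MeasurableSpace Ω] {P : Measure Ω} [IsProbabilityMeasure P] {X : Ω → ℝ}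
    (hX : Measurable X) (h4 : Integrable (fun ω => X ω ^ 4) P) :
    ∫ ω, (X ω - ∫ ω', X ω' ∂P) ^ 4 ∂P ≤ 16 * ∫ ω, X ω ^ 4 ∂P := by
  have i2 := int_pow hX h4 2 (by norm_num)
  have i1 : Integrable X P := by simpa using int_pow hX h4 1 (by norm_num)
  set a := ∫ ω', X ω' ∂P with ha
  have h1 : a ^ 2 ≤ ∫ ω, X ω ^ 2 ∂P := sq_int_le i1 i2
  have h2 : (∫ ω, X ω ^ 2 ∂P) ^ 2 ≤ ∫ ω, X ω ^ 4 ∂P := by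
    have := sq_int_le i2 (by simpa only [← pow_mul] using h4)
    simpa only [← pow_mul] using this
  have h3 : a ^ 4 ≤ ∫ ω, X ω ^ 4 ∂P := by
    have := pow_le_pow_left₀ (sq_nonneg a) h1 2
    rw [← pow_mul] at this
    exact this.trans h2
  calc ∫ ω, (X ω - a) ^ 4 ∂P ≤ ∫ ω, (8 * X ω ^ 4 + 8 * a ^ 4) ∂P := by
        apply integral_mono (int_sub4 hX measurable_const h4 (integrable_const _))
          (iadd (h4.const_mul 8) (integrable_const _))
        intro ω; exact four_sub _ _
    _ = 8 * ∫ ω, X ω ^ 4 ∂P + 8 * a ^ 4 := by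
        rw [integral_add (h4.const_mul 8) (integrable_const _), integral_const_mul]; simp
    _ ≤ _ := by linarith

lemma int_le_of_lint {Ω : Type*} [MeasurableSpace Ω] {P : Measure Ω} {f : Ω → ℝ}
    (hf : Measurable f) (h0 : ∀ ω, 0 ≤ f ω) (C : ℝ) (hC : 0 ≤ C)
    (h : ∫⁻ ω, ENNReal.ofReal (f ω) ∂P ≤ ENNReal.ofReal C) : ∫ ω, f ω ∂P ≤ C := by
  rw [integral_eq_lintegral_of_nonneg_ae (ae_of_all _ h0) hf.aestronglyMeasurable]
  exact ENNReal.toReal_le_of_le_ofReal hC h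

/-- Sum of squares decomposition of the pooled variance estimator. -/
lemma sigmaHat_eq {Ω : Type*} (μ : CI) (ε : ℕ → Ω → CI) (η : ℕ → ℕ → Ω → CI)
    (A : ℕ) (n : ℕ → ℕ) (hn : ∀ i, 0 < n i) (ω : Ω) (t : I01) (v : ℝ) :
    sigmaHatSq μ ε η A n ω t = ((∑ i ∈ Finset.range A, (n i : ℝ)) - (A : ℝ))⁻¹ *
      ((∑ i ∈ Finset.range A, ∑ j ∈ Finset.range (n i), ((η i j ω t) ^ 2 - v))
        + (∑ i ∈ Finset.range A, (n i : ℝ)) * v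
        - ∑ i ∈ Finset.range A, (∑ j ∈ Finset.range (n i), η i j ω t) ^ 2 / (n i : ℝ)) := by
  rw [sigmaHatSq]
  congr 1
  rw [Finset.sum_mul, ← Finset.sum_add_distrib, ← Finset.sum_sub_distrib]
  refine Finset.sum_congr rfl fun i _ => ?_
  have hni : (n i : ℝ) ≠ 0 := by exact_mod_cast (hn i).ne'
  set T := ∑ j ∈ Finset.range (n i), η i j ω t with hT
  have e : ∀ j, Xre μ ε η i j ω t - XbarRe μ ε η (n i) i ω t = η i j ω t - T / n i := by
    intro j
    simp only [Xre, XbarRe, Finset.sum_add_distrib, Finset.sum_const, Finset.card_range,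
      nsmul_eq_mul, ← hT]
    field_simp
    ring
  simp only [e, sub_sq, Finset.sum_add_distrib, Finset.sum_sub_distrib, Finset.sum_const,
    Finset.card_range, nsmul_eq_mul]
  rw [← Finset.sum_mul, ← Finset.mul_sum, ← hT]
  field_simp
  ring

/-- Everything about one coordinate. -/
lemma moments {Ω : Type*} [MeasurableSpace Ω] (P : Measure Ω) [IsProbabilityMeasure P]
    [MeasurableSpace CI] [BorelSpace CI] (η : ℕ → ℕ → Ω → CI)
    (hmeas : ∀ i j, Measurable (η i j))
    (hind : iIndepFun (fun (p : (_ : ℕ) × ℕ) => η p.1 p.2) P)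
    (hid : ∀ i j, Measure.map (η i j) P = Measure.map (η 0 0) P)
    (hcent : ∀ i j (t : I01), ∫ ω, η i j ω t ∂P = 0)
    (hmom8 : ∀ i j, ∫⁻ ω, ENNReal.ofReal (‖η i j ω‖ ^ ((8:ℝ))) ∂P < ⊤)
    (th Kt : ℝ) (hth : 1/4 < th) (M : Ω → ℝ) (hM0 : ∀ ω, 0 ≤ M ω)
    (hM4 : ∀ i j, ∫⁻ ω, ENNReal.ofReal (‖η i j ω‖ ^ ((4:ℝ)) * M ω ^ ((4:ℝ))) ∂P
      ≤ ENNReal.ofReal Kt)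
    (hHold : ∀ i j, ∀ᵐ ω ∂P, ∀ s t : I01,
      |η i j ω s - η i j ω t| ≤ M ω * |(s : ℝ) - (t : ℝ)| ^ th)
    (hcont : Continuous (fun t : I01 => ∫ ω, (η 0 0 ω t) ^ 2 ∂P))
    (hpos : ∀ t : I01, 0 < ∫ ω, (η 0 0 ω t) ^ 2 ∂P) :
    ∃ K : ℝ, 0 ≤ K ∧ ∀ F : Finset ((_ : ℕ) × ℕ),
      (∃ W : Ω → ENNReal, Measurable W ∧
        ∫⁻ ω, W ω ∂P ≤ ENNReal.ofReal (K * (F.card : ℝ) ^ 2) ∧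
        ∀ ω t, ENNReal.ofReal ((∑ p ∈ F, η p.1 p.2 ω t) ^ 4) ≤ W ω) ∧
      (∃ W : Ω → ENNReal, Measurable W ∧
        ∫⁻ ω, W ω ∂P ≤ ENNReal.ofReal (K * (F.card : ℝ) ^ 2) ∧
        ∀ ω t, ENNReal.ofReal ((∑ p ∈ F, ((η p.1 p.2 ω t) ^ 2
          - ∫ ω', (η 0 0 ω' t) ^ 2 ∂P)) ^ 4) ≤ W ω) := by
  have mev : ∀ t : I01, Measurable fun f : CI => f t := fun t =>
    (ContinuousEvalConst.continuous_eval_const t).measurable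
  have mnorm : Measurable fun f : CI => ‖f‖ := continuous_norm.measurable
  have mη : ∀ i j t, Measurable fun ω => η i j ω t := fun i j t => (mev t).comp (hmeas i j)
  have mN : ∀ i j, Measurable fun ω => ‖η i j ω‖ := fun i j => mnorm.comp (hmeas i j)
  have hident : ∀ i j, IdentDistrib (η i j) (η 0 0) P P := fun i j =>
    ⟨(hmeas i j).aemeasurable, (hmeas 0 0).aemeasurable, hid i j⟩
  have intid : ∀ i j (f : CI → ℝ), Measurable f → ∫ ω, f (η i j ω) ∂P = ∫ ω, f (η 0 0 ω) ∂P :=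
    fun i j f hf => ((hident i j).comp hf).integral_eq
  have habs : ∀ i j ω t, |η i j ω t| ≤ ‖η i j ω‖ := fun i j ω t => (η i j ω).norm_coe_le_norm t
  -- eighth moments
  have i8 : ∀ i j, Integrable (fun ω => ‖η i j ω‖ ^ 8) P := by
    intro i j
    refine ⟨((mN i j).pow_const 8).aestronglyMeasurable, ?_⟩
    rw [hasFiniteIntegral_iff_ofReal (ae_of_all _ fun ω => by positivity)]
    have := hmom8 i j
    simpa only [show (8:ℝ) = ((8:ℕ):ℝ) by norm_num, Real.rpow_natCast] using this
  set C8 := ∫ ω, ‖η 0 0 ω‖ ^ 8 ∂P with hC8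
  have hC80 : 0 ≤ C8 := integral_nonneg fun ω => by positivity
  have e8 : ∀ i j, ∫ ω, ‖η i j ω‖ ^ 8 ∂P = C8 := fun i j =>
    intid i j (fun f => ‖f‖ ^ 8) (mnorm.pow_const 8)
  have iN4 : ∀ i j, Integrable (fun ω => ‖η i j ω‖ ^ 4) P := by
    intro i j
    refine Integrable.mono' (g := fun ω => 1 + ‖η i j ω‖ ^ 8) (iadd (integrable_const _) (i8 i j))
      ((mN i j).pow_const 4).aestronglyMeasurable (ae_of_all _ fun ω => ?_)
    rw [Real.norm_eq_abs, abs_of_nonneg (by positivity)]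
    nlinarith [sq_nonneg (‖η i j ω‖ ^ 4 - 1)]
  have eN4 : ∀ i j, ∫ ω, ‖η i j ω‖ ^ 4 ∂P = ∫ ω, ‖η 0 0 ω‖ ^ 4 ∂P := fun i j =>
    intid i j (fun f => ‖f‖ ^ 4) (mnorm.pow_const 4)
  set E4 := ∫ ω, ‖η 0 0 ω‖ ^ 4 ∂P with hE4
  have hE40 : 0 ≤ E4 := integral_nonneg fun ω => by positivity
  have le4 : ∀ i j ω t, η i j ω t ^ 4 ≤ ‖η i j ω‖ ^ 4 := fun i j ω t => by
    have := pow_le_pow_left₀ (abs_nonneg _) (habs i j ω t) 4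
    rwa [pow_abs, abs_of_nonneg (by positivity)] at this
  have le8 : ∀ i j ω t, (η i j ω t ^ 2) ^ 4 ≤ ‖η i j ω‖ ^ 8 := fun i j ω t => by
    have := pow_le_pow_left₀ (abs_nonneg _) (habs i j ω t) 8
    rw [pow_abs, abs_of_nonneg (by positivity)] at this
    rwa [← pow_mul]
  have i4 : ∀ i j t, Integrable (fun ω => η i j ω t ^ 4) P := fun i j t =>
    Integrable.mono' (iN4 i j) ((mη i j t).pow_const 4).aestronglyMeasurable
      (ae_of_all _ fun ω => by
        rw [Real.norm_eq_abs, abs_of_nonneg (by positivity)]; exact le4 i j ω t)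
  have i24 : ∀ i j t, Integrable (fun ω => (η i j ω t ^ 2) ^ 4) P := fun i j t =>
    Integrable.mono' (i8 i j) (((mη i j t).pow_const 2).pow_const 4).aestronglyMeasurable
      (ae_of_all _ fun ω => by
        rw [Real.norm_eq_abs, abs_of_nonneg (by positivity)]; exact le8 i j ω t)
  have i2 : ∀ i j t, Integrable (fun ω => η i j ω t ^ 2) P := fun i j t =>
    int_pow (mη i j t) (i4 i j t) 2 (by norm_num)
  -- the Hölder moment bound
  set Kp := max Kt 0 with hKp
  have hKp0 : 0 ≤ Kp := le_max_right _ _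
  have hM4' : ∀ i j, ∫⁻ ω, ENNReal.ofReal (‖η i j ω‖ ^ 4 * M ω ^ 4) ∂P ≤ ENNReal.ofReal Kp := by
    intro i j
    refine le_trans ?_ ((hM4 i j).trans (ENNReal.ofReal_le_ofReal (le_max_left _ _)))
    simp only [show (4:ℝ) = ((4:ℕ):ℝ) by norm_num, Real.rpow_natCast, le_refl]
  have hb : ∀ i j (f : Ω → ℝ) (q : ℝ), Measurable f → (∀ ω, 0 ≤ f ω) → 0 ≤ q →
      (∀ᵐ ω ∂P, f ω ≤ (‖η i j ω‖ ^ 4 * M ω ^ 4) * q) → ∫ ω, f ω ∂P ≤ Kp * q := by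
    intro i j f q hf hf0 hq hle
    refine int_le_of_lint hf hf0 _ (by positivity) ?_
    calc ∫⁻ ω, ENNReal.ofReal (f ω) ∂P
        ≤ ∫⁻ ω, ENNReal.ofReal (‖η i j ω‖ ^ 4 * M ω ^ 4) * ENNReal.ofReal q ∂P := by
          refine lintegral_mono_ae ?_
          filter_upwards [hle] with ω hω
          rw [← ENNReal.ofReal_mul (by have := hM0 ω; positivity)]
          exact ENNReal.ofReal_le_ofReal hω
      _ = (∫⁻ ω, ENNReal.ofReal (‖η i j ω‖ ^ 4 * M ω ^ 4) ∂P) * ENNReal.ofReal q :=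
          lintegral_mul_const' _ _ ENNReal.ofReal_ne_top
      _ ≤ ENNReal.ofReal Kp * ENNReal.ofReal q := by gcongr; exact hM4' i j
      _ = _ := (ENNReal.ofReal_mul hKp0).symm
  have hinc4 : ∀ i j, ∀ᵐ ω ∂P, ∀ s t : I01,
      (η i j ω s - η i j ω t) ^ 4 ≤ M ω ^ 4 * |(s:ℝ) - t| ^ (4 * th) := by
    intro i j
    filter_upwards [hHold i j] with ω hω s t
    have := pow_le_pow_left₀ (abs_nonneg _) (hω s t) 4
    rw [pow_abs, abs_of_nonneg (by positivity), mul_pow] at this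
    refine this.trans (le_of_eq ?_)
    rw [← Real.rpow_natCast (|(s:ℝ) - t| ^ th) 4, ← Real.rpow_mul (abs_nonneg _)]
    congr 2; push_cast; ring
  have hE4pos : 0 < E4 := by
    have h1 := hpos 0
    have h2 : (∫ ω, η 0 0 ω 0 ^ 2 ∂P) ^ 2 ≤ E4 := by
      refine (sq_int_le (i2 0 0 0) (by simpa only [← pow_mul] using i4 0 0 0)).trans ?_
      simp only [← pow_mul]
      exact integral_mono (i4 0 0 0) (iN4 0 0) fun ω => le4 0 0 ω 0
    exact lt_of_lt_of_le (by positivity) h2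
  have hinc1 : ∀ s t : I01, ∫ ω, (η 0 0 ω s - η 0 0 ω t) ^ 4 ∂P
      ≤ Kp / E4 * |(s:ℝ) - t| ^ (4 * th) := by
    intro s t
    have hI : IndepFun (η 0 1) (η 0 0) P :=
      hind.indepFun (i := ⟨0, 1⟩) (j := ⟨0, 0⟩) (by simp)
    have hI2 : IndepFun (fun ω => ‖η 0 1 ω‖ ^ 4) (fun ω => (η 0 0 ω s - η 0 0 ω t) ^ 4) P :=
      hI.comp (φ := fun f : CI => ‖f‖ ^ 4) (ψ := fun f : CI => (f s - f t) ^ 4)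
        (mnorm.pow_const 4) (((mev s).sub (mev t)).pow_const 4)
    have hm1 : Measurable fun ω => ‖η 0 1 ω‖ ^ 4 := (mN 0 1).pow_const 4
    have hm2 : Measurable fun ω => (η 0 0 ω s - η 0 0 ω t) ^ 4 :=
      ((mη 0 0 s).sub (mη 0 0 t)).pow_const 4
    have e := hI2.integral_fun_mul_eq_mul_integral hm1.aestronglyMeasurable
      hm2.aestronglyMeasurable
    have hle := hb 0 1 (fun ω => ‖η 0 1 ω‖ ^ 4 * (η 0 0 ω s - η 0 0 ω t) ^ 4)
      (|(s:ℝ) - t| ^ (4 * th)) (hm1.mul hm2) (fun ω => by positivity) (by positivity) (by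
        filter_upwards [hinc4 0 0] with ω hω
        rw [mul_assoc]
        exact mul_le_mul_of_nonneg_left (hω s t) (by positivity))
    rw [e, eN4] at hle
    rw [div_mul_eq_mul_div, le_div_iff₀ hE4pos]
    linarith
  have hinc2 : ∀ i j (s t : I01), ∫ ω, (η i j ω s ^ 2 - η i j ω t ^ 2) ^ 4 ∂P
      ≤ Kp * (16 * |(s:ℝ) - t| ^ (4 * th)) := by
    intro i j s t
    refine hb i j _ _ ((((mη i j s).pow_const 2).sub ((mη i j t).pow_const 2)).pow_const 4)
      (fun ω => by positivity) (by positivity) ?_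
    filter_upwards [hinc4 i j] with ω hω
    have h1 := four_add (η i j ω s) (η i j ω t)
    have h2 := le4 i j ω s
    have h3 := le4 i j ω t
    have h4 : (η i j ω s + η i j ω t) ^ 4 ≤ 16 * ‖η i j ω‖ ^ 4 := by linarith
    calc (η i j ω s ^ 2 - η i j ω t ^ 2) ^ 4
        = (η i j ω s + η i j ω t) ^ 4 * (η i j ω s - η i j ω t) ^ 4 := by ring
      _ ≤ (16 * ‖η i j ω‖ ^ 4) * (M ω ^ 4 * |(s:ℝ) - t| ^ (4 * th)) :=
          mul_le_mul h4 (hω s t) (by positivity) (by positivity)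
      _ = _ := by ring
  have e2 : ∀ i j t, ∫ ω, η i j ω t ^ 2 ∂P = ∫ ω, η 0 0 ω t ^ 2 ∂P := fun i j t =>
    intid i j (fun f => f t ^ 2) ((mev t).pow_const 2)
  set sg : CI := ⟨fun t : I01 => ∫ ω, (η 0 0 ω t) ^ 2 ∂P, hcont⟩ with hsg
  have hsgt : ∀ t, sg t = ∫ ω, (η 0 0 ω t) ^ 2 ∂P := fun t => rfl
  obtain ⟨K1, hK1, H1⟩ := supsum th hth P (fun (p : (_ : ℕ) × ℕ) => η p.1 p.2)
    (fun p t => mη _ _ t)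
    (fun t => hind.comp (fun _ f => f t) (fun _ => mev t))
    (fun s t => hind.comp (fun _ f => f s - f t) (fun _ => (mev s).sub (mev t)))
    (fun p t => hcent _ _ t) (fun p t => i4 _ _ t) (E4 + Kp / E4) (by positivity)
    (fun p t => by
      have : ∫ ω, η p.1 p.2 ω t ^ 4 ∂P ≤ E4 := by
        rw [← eN4 p.1 p.2]
        exact integral_mono (i4 _ _ t) (iN4 _ _) fun ω => le4 _ _ ω t
      have : 0 ≤ Kp / E4 := by positivity
      linarith)
    (fun p s t => by
      have h1 := intid p.1 p.2 (fun f => (f s - f t) ^ 4) (((mev s).sub (mev t)).pow_const 4)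
      rw [h1]
      refine (hinc1 s t).trans ?_
      gcongr
      linarith)
  obtain ⟨K2, hK2, H2⟩ := supsum th hth P (fun (p : (_ : ℕ) × ℕ) ω => η p.1 p.2 ω ^ 2 - sg)
    (fun p t => by
      simpa using ((mη p.1 p.2 t).pow_const 2).sub_const (sg t))
    (fun t => hind.comp (fun _ f => (f ^ 2 - sg) t) (fun _ => by
      simpa using ((mev t).pow_const 2).sub_const (sg t)))
    (fun s t => hind.comp (fun _ f => (f ^ 2 - sg) s - (f ^ 2 - sg) t) (fun _ => by
      simp only [ContinuousMap.sub_apply, ContinuousMap.pow_apply]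
      exact (((mev s).pow_const 2).sub_const (sg s)).sub
        (((mev t).pow_const 2).sub_const (sg t))))
    (fun p t => by
      simp only [ContinuousMap.sub_apply, ContinuousMap.pow_apply]
      rw [integral_sub (i2 _ _ t) (integrable_const _), e2, hsgt]; simp)
    (fun p t => by
      simp only [ContinuousMap.sub_apply, ContinuousMap.pow_apply]
      exact int_sub4 ((mη _ _ t).pow_const 2) measurable_const (i24 _ _ t) (integrable_const _))
    (16 * C8 + 256 * Kp) (by positivity)
    (fun p t => by
      simp only [ContinuousMap.sub_apply, ContinuousMap.pow_apply]
      have h1 := center4 ((mη p.1 p.2 t).pow_const 2) (i24 p.1 p.2 t)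
      rw [e2, ← hsgt] at h1
      have h2 : ∫ ω, (η p.1 p.2 ω t ^ 2) ^ 4 ∂P ≤ C8 := by
        rw [← e8 p.1 p.2]
        exact integral_mono (i24 _ _ t) (i8 _ _) fun ω => le8 _ _ ω t
      linarith)
    (fun p s t => by
      simp only [ContinuousMap.sub_apply, ContinuousMap.pow_apply]
      have h1 := center4 (((mη p.1 p.2 s).pow_const 2).sub ((mη p.1 p.2 t).pow_const 2))
        (int_sub4 ((mη p.1 p.2 s).pow_const 2) ((mη p.1 p.2 t).pow_const 2) (i24 p.1 p.2 s)
          (i24 p.1 p.2 t))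
      have h3 : ∫ ω, (η p.1 p.2 ω s ^ 2 - η p.1 p.2 ω t ^ 2) ∂P = sg s - sg t := by
        rw [integral_sub (i2 _ _ s) (i2 _ _ t), e2 _ _ s, e2 _ _ t]; rfl
      simp only [Pi.sub_apply] at h1
      rw [h3] at h1
      have h2 := hinc2 p.1 p.2 s t
      have e : ∀ ω, η p.1 p.2 ω s ^ 2 - sg s - (η p.1 p.2 ω t ^ 2 - sg t)
        = η p.1 p.2 ω s ^ 2 - η p.1 p.2 ω t ^ 2 - (sg s - sg t) := fun ω => by ring
      simp only [e]
      have h5 : 0 ≤ C8 * |(s:ℝ) - t| ^ (4 * th) := by positivity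
      linarith)
  refine ⟨K1 + K2, by positivity, fun F => ⟨?_, ?_⟩⟩
  · obtain ⟨W, hW, hW1, hW2⟩ := H1 F
    refine ⟨W, hW, hW1.trans (ENNReal.ofReal_le_ofReal ?_), hW2⟩
    gcongr; linarith
  · obtain ⟨W, hW, hW1, hW2⟩ := H2 F
    refine ⟨W, hW, hW1.trans (ENNReal.ofReal_le_ofReal ?_), fun ω t => ?_⟩
    · gcongr; linarith
    · have := hW2 ω t
      simpa only [ContinuousMap.sub_apply, ContinuousMap.pow_apply, hsgt] using this

lemma onecoord {Ω : Type*} [MeasurableSpace Ω] (P : Measure Ω) [IsProbabilityMeasure P]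
    [MeasurableSpace CI] [BorelSpace CI] (μ : CI) (ε : ℕ → Ω → CI) (η : ℕ → ℕ → Ω → CI)
    (hmeas : ∀ i j, Measurable (η i j))
    (hind : iIndepFun (fun (p : (_ : ℕ) × ℕ) => η p.1 p.2) P)
    (hid : ∀ i j, Measure.map (η i j) P = Measure.map (η 0 0) P)
    (hcent : ∀ i j (t : I01), ∫ ω, η i j ω t ∂P = 0)
    (hmom8 : ∀ i j, ∫⁻ ω, ENNReal.ofReal (‖η i j ω‖ ^ ((8:ℝ))) ∂P < ⊤)
    (th Kt : ℝ) (hth : 1/4 < th) (M : Ω → ℝ) (hM0 : ∀ ω, 0 ≤ M ω)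
    (hM4 : ∀ i j, ∫⁻ ω, ENNReal.ofReal (‖η i j ω‖ ^ ((4:ℝ)) * M ω ^ ((4:ℝ))) ∂P
      ≤ ENNReal.ofReal Kt)
    (hHold : ∀ i j, ∀ᵐ ω ∂P, ∀ s t : I01,
      |η i j ω s - η i j ω t| ≤ M ω * |(s : ℝ) - (t : ℝ)| ^ th)
    (hcont : Continuous (fun t : I01 => ∫ ω, (η 0 0 ω t) ^ 2 ∂P))
    (hpos : ∀ t : I01, 0 < ∫ ω, (η 0 0 ω t) ^ 2 ∂P)
    (A : ℕ → ℕ) (hA : Tendsto A atTop atTop)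
    (n : ℕ → ℕ → ℕ) (hnpos : ∀ k i, 0 < n k i)
    (hAN : Tendsto (fun k => (A k : ℝ) /
      Real.sqrt (∑ i ∈ Finset.range (A k), (n k i : ℝ))) atTop (𝓝 0)) (δ : ℝ) (hδ : 0 < δ) :
    Tendsto (fun k => P {ω | ∃ t : I01, ¬ (0 < sigmaHatSq μ ε η (A k) (n k) ω t ∧
        |√(∑ i ∈ Finset.range (A k), (n k i : ℝ)) *
            (Real.log (sigmaHatSq μ ε η (A k) (n k) ω t)
              - Real.log (∫ ω', (η 0 0 ω' t) ^ 2 ∂P))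
          - (√(∑ i ∈ Finset.range (A k), (n k i : ℝ))
              / ((∑ i ∈ Finset.range (A k), (n k i : ℝ)) - (A k : ℝ))) *
            ((∑ i ∈ Finset.range (A k), ∑ j ∈ Finset.range (n k i),
              ((η i j ω t) ^ 2 - ∫ ω', (η 0 0 ω' t) ^ 2 ∂P))
                  / (∫ ω', (η 0 0 ω' t) ^ 2 ∂P))| ≤ δ)}) atTop (𝓝 0) := by
  obtain ⟨K, hK, HK⟩ := moments P η hmeas hind hid hcent hmom8 th Kt hth M hM0 hM4 hHold hcont hpos
  obtain ⟨t0, ht0⟩ : ∃ t0 : I01, ∀ t : I01,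
      ∫ ω, (η 0 0 ω t0) ^ 2 ∂P ≤ ∫ ω, (η 0 0 ω t) ^ 2 ∂P := by
    obtain ⟨t0, _, h⟩ := isCompact_univ.exists_isMinOn (Set.univ_nonempty (α := I01))
      hcont.continuousOn
    exact ⟨t0, fun t => h (Set.mem_univ t)⟩
  obtain ⟨d, hd0, Hd⟩ := det_delta (∫ ω, (η 0 0 ω t0) ^ 2 ∂P) δ (hpos t0) hδ
  set N : ℕ → ℝ := fun k => ∑ i ∈ Finset.range (A k), (n k i : ℝ) with hN
  have hNA : ∀ k, (A k : ℝ) ≤ N k := by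
    intro k
    calc (A k : ℝ) = ∑ i ∈ Finset.range (A k), (1:ℝ) := by simp
      _ ≤ _ := Finset.sum_le_sum fun i _ => by exact_mod_cast hnpos k i
  have hNtop : Tendsto N atTop atTop :=
    tendsto_atTop_mono hNA (tendsto_natCast_atTop_atTop.comp hA)
  have hN1 : ∀ᶠ k in atTop, 1 ≤ N k := hNtop.eventually_ge_atTop 1
  have hAd : ∀ᶠ k in atTop, (A k : ℝ) / √(N k) ≤ d := hAN.eventually_le_const hd0
  -- the limit bound
  have hlim : Tendsto (fun k => ENNReal.ofReal (K / d ^ 4 * (N k)⁻¹)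
      + ENNReal.ofReal ((1 + K) / d * ((A k : ℝ) / √(N k)))) atTop (𝓝 0) := by
    have h1 : Tendsto (fun k => K / d ^ 4 * (N k)⁻¹) atTop (𝓝 0) := by
      simpa using (tendsto_inv_atTop_zero.comp hNtop).const_mul (K / d ^ 4)
    have h2 : Tendsto (fun k => (1 + K) / d * ((A k : ℝ) / √(N k))) atTop (𝓝 0) := by
      simpa using hAN.const_mul ((1 + K) / d)
    simpa using (ENNReal.tendsto_ofReal h1).add (ENNReal.tendsto_ofReal h2)
  refine tendsto_of_tendsto_of_tendsto_of_le_of_le' tendsto_const_nhds hlim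
    (Eventually.of_forall fun _ => zero_le) ?_
  filter_upwards [hN1, hAd] with k hk1 hk2
  have hNk0 : 0 < N k := by linarith
  have hsq0 : 0 < √(N k) := Real.sqrt_pos.2 hNk0
  -- the quadratic part
  obtain ⟨WS, hWS, hWS1, hWS2⟩ :=
    (HK ((Finset.range (A k)).sigma fun i => Finset.range (n k i))).2
  have hcard : ((((Finset.range (A k)).sigma fun i => Finset.range (n k i)).card : ℕ) : ℝ)
      = N k := by
    rw [Finset.card_sigma]; simp [hN]
  rw [hcard] at hWS1
  simp only [Finset.sum_sigma] at hWS2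
  -- the group mean part
  have hrow : ∀ i, ∃ W : Ω → ENNReal, Measurable W ∧
      ∫⁻ ω, W ω ∂P ≤ ENNReal.ofReal (K * (n k i : ℝ) ^ 2) ∧
      ∀ ω t, ENNReal.ofReal ((∑ j ∈ Finset.range (n k i), η i j ω t) ^ 4) ≤ W ω := by
    intro i
    obtain ⟨W, hW, hW1, hW2⟩ := (HK (({i} : Finset ℕ).sigma fun i => Finset.range (n k i))).1
    refine ⟨W, hW, ?_, ?_⟩
    · simpa [Finset.card_sigma] using hW1
    · intro ω t
      simpa [Finset.sum_sigma] using hW2 ω t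
  choose W hW hW1 hW2 using hrow
  set WR : Ω → ENNReal := fun ω => ∑ i ∈ Finset.range (A k),
    (1 + ENNReal.ofReal (((n k i : ℝ) ^ 2)⁻¹) * W i ω) with hWR
  have hWRm : Measurable WR := Finset.measurable_sum _ fun i _ =>
    measurable_const.add ((hW i).const_mul _)
  have hWR1 : ∫⁻ ω, WR ω ∂P ≤ ENNReal.ofReal ((1 + K) * A k) := by
    have hterm : ∀ i, Measurable fun ω => 1 + ENNReal.ofReal (((n k i : ℝ) ^ 2)⁻¹) * W i ω :=
      fun i => measurable_const.add ((hW i).const_mul _)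
    simp only [hWR]
    rw [lintegral_finsetSum _ fun i _ => hterm i]
    calc _ ≤ ∑ i ∈ Finset.range (A k), ENNReal.ofReal (1 + K) := by
          refine Finset.sum_le_sum fun i _ => ?_
          have hni : (0:ℝ) < n k i := by exact_mod_cast hnpos k i
          rw [lintegral_add_left measurable_const, lintegral_const_mul _ (hW i)]
          calc _ ≤ 1 + ENNReal.ofReal (((n k i : ℝ) ^ 2)⁻¹)
                * ENNReal.ofReal (K * (n k i : ℝ) ^ 2) := by
                gcongr
                · simp
                · exact hW1 i
            _ = _ := by
                rw [← ENNReal.ofReal_mul (by positivity), ENNReal.ofReal_add (by norm_num) hK]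
                congr 1
                · simp
                · congr 1; field_simp
      _ = _ := by
          rw [Finset.sum_const, Finset.card_range, nsmul_eq_mul, mul_comm,
            ENNReal.ofReal_mul (by positivity)]
          simp
  have hWR2 : ∀ ω t, ENNReal.ofReal (∑ i ∈ Finset.range (A k),
      (∑ j ∈ Finset.range (n k i), η i j ω t) ^ 2 / (n k i : ℝ)) ≤ WR ω := by
    intro ω t
    rw [ENNReal.ofReal_sum_of_nonneg fun i _ => by positivity]
    refine Finset.sum_le_sum fun i _ => ?_
    have hni : (0:ℝ) < n k i := by exact_mod_cast hnpos k i
    set z := ∑ j ∈ Finset.range (n k i), η i j ω t with hz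
    calc ENNReal.ofReal (z ^ 2 / n k i)
        ≤ ENNReal.ofReal (1 + ((n k i : ℝ) ^ 2)⁻¹ * z ^ 4) := by
          apply ENNReal.ofReal_le_ofReal
          have e : ((n k i : ℝ) ^ 2)⁻¹ * z ^ 4 = (z ^ 2 / n k i) ^ 2 := by field_simp
          rw [e]
          nlinarith [sq_nonneg (z ^ 2 / n k i - 1)]
      _ = 1 + ENNReal.ofReal (((n k i : ℝ) ^ 2)⁻¹) * ENNReal.ofReal (z ^ 4) := by
          rw [ENNReal.ofReal_add (by norm_num) (by positivity), ENNReal.ofReal_mul (by positivity)]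
          simp
      _ ≤ _ := by gcongr; exact hW2 i ω t
  -- Markov
  have hp1 : 0 < d ^ 4 * N k ^ 3 := by positivity
  have hp2 : 0 < d * √(N k) := by positivity
  have m1 : P {ω | ENNReal.ofReal (d ^ 4 * N k ^ 3) ≤ WS ω}
      ≤ ENNReal.ofReal (K / d ^ 4 * (N k)⁻¹) := by
    refine (meas_ge_le_lintegral_div hWS.aemeasurable (by simpa using hp1)
      ENNReal.ofReal_ne_top).trans ?_
    refine (ENNReal.div_le_div_right hWS1 _).trans ?_
    rw [← ENNReal.ofReal_div_of_pos hp1]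
    apply ENNReal.ofReal_le_ofReal
    apply le_of_eq; field_simp
  have m2 : P {ω | ENNReal.ofReal (d * √(N k)) ≤ WR ω}
      ≤ ENNReal.ofReal ((1 + K) / d * ((A k : ℝ) / √(N k))) := by
    refine (meas_ge_le_lintegral_div hWRm.aemeasurable (by simpa using hp2)
      ENNReal.ofReal_ne_top).trans ?_
    refine (ENNReal.div_le_div_right hWR1 _).trans ?_
    rw [← ENNReal.ofReal_div_of_pos hp2]
    apply ENNReal.ofReal_le_ofReal
    apply le_of_eq; field_simp
  refine le_trans (measure_mono ?_) ((measure_union_le _ _).trans (add_le_add m1 m2))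
  rintro ω ⟨t, ht⟩
  by_contra hcon
  simp only [Set.mem_union, Set.mem_ofPred_eq, not_or, not_le] at hcon
  apply ht
  have b1 := (hWS2 ω t).trans hcon.1.le
  have b2 := (hWR2 ω t).trans hcon.2.le
  rw [ENNReal.ofReal_le_ofReal_iff hp1.le] at b1
  rw [ENNReal.ofReal_le_ofReal_iff hp2.le] at b2
  rw [sigmaHat_eq μ ε η (A k) (n k) (hnpos k) ω t (∫ ω', (η 0 0 ω' t) ^ 2 ∂P)]
  exact Hd (N k) (A k) _ _ _ hk1 (by positivity) (by rwa [div_le_iff₀ hsq0] at hk2) (ht0 t)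
    (Finset.sum_nonneg fun i _ => by positivity) b2 b1

/-- **Delta-method expansion (5.16).**
In the functional random effects model under Assumption D, with `σ₁², σ₂²` continuous and
strictly positive, `A → ∞`, `min_i n_i → ∞` and `A/√N → 0`:
`sup_t |√N(log λ̂(t) − log λ(t)) − (√N/(N−A)) Σ_i Σ_j {(η_{1,i,j}(t)²−σ₁²(t))/σ₁²(t) −
(η_{2,i,j}(t)²−σ₂²(t))/σ₂²(t)}| → 0` in probability, where `λ = σ₁²/σ₂²`, `λ̂ = σ̂₁²/σ̂₂²`. -/
theorem statement13 {Ω : Type*} [MeasurableSpace Ω] (P : Measure Ω) [IsProbabilityMeasure P]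
    [MeasurableSpace CI] [BorelSpace CI]
    (μ1 μ2 : CI) (ε1 ε2 : ℕ → Ω → CI) (η1 η2 : ℕ → ℕ → Ω → CI)
    (hmeasε : ∀ i, Measurable (ε1 i) ∧ Measurable (ε2 i))
    (hmeasη : ∀ i j, Measurable (η1 i j) ∧ Measurable (η2 i j))
    (hindep : iIndepFun (m := fun _ : ℕ ⊕ ℕ × ℕ => (inferInstance : MeasurableSpace (CI × CI)))
      (effFam ε1 ε2 η1 η2) P)
    (hidε : ∀ i, Measure.map (fun ω => (ε1 i ω, ε2 i ω)) P
      = Measure.map (fun ω => (ε1 0 ω, ε2 0 ω)) P)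
    (hidη : ∀ i j, Measure.map (fun ω => (η1 i j ω, η2 i j ω)) P
      = Measure.map (fun ω => (η1 0 0 ω, η2 0 0 ω)) P)
    (hcentε : ∀ i (t : I01), (∫ ω, ε1 i ω t ∂P = 0) ∧ (∫ ω, ε2 i ω t ∂P = 0))
    (hcentη : ∀ i j (t : I01), (∫ ω, η1 i j ω t ∂P = 0) ∧ (∫ ω, η2 i j ω t ∂P = 0))
    -- Assumption D, (D1): moment bounds for the individual errors
    (ν1 ν2 K : ℝ) (hν1 : 0 < ν1) (hν2 : 0 < ν2)
    (hmom1 : ∀ i j, ∫⁻ ω, ENNReal.ofReal (‖η1 i j ω‖ ^ ((4:ℝ) + ν1)) ∂P ≤ ENNReal.ofReal K)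
    (hmom2 : ∀ i j, ∫⁻ ω, ENNReal.ofReal (‖η2 i j ω‖ ^ ((4:ℝ) + ν2)) ∂P ≤ ENNReal.ofReal K)
    (hmom18 : ∀ i j, ∫⁻ ω, ENNReal.ofReal (‖η1 i j ω‖ ^ ((8:ℝ))) ∂P < ⊤)
    (hmom28 : ∀ i j, ∫⁻ ω, ENNReal.ofReal (‖η2 i j ω‖ ^ ((8:ℝ))) ∂P < ⊤)
    -- Assumption D, (D2): Hölder condition
    (ϑ Ktilde : ℝ) (hϑ : 1/4 < ϑ)
    (M1 M2 : Ω → ℝ) (hM10 : ∀ ω, 0 ≤ M1 ω) (hM20 : ∀ ω, 0 ≤ M2 ω)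
    (hM14 : ∀ i j, ∫⁻ ω, ENNReal.ofReal (‖η1 i j ω‖ ^ ((4:ℝ)) * M1 ω ^ ((4:ℝ))) ∂P
      ≤ ENNReal.ofReal Ktilde)
    (hM24 : ∀ i j, ∫⁻ ω, ENNReal.ofReal (‖η2 i j ω‖ ^ ((4:ℝ)) * M2 ω ^ ((4:ℝ))) ∂P
      ≤ ENNReal.ofReal Ktilde)
    (hHold1 : ∀ i j, ∀ᵐ ω ∂P, ∀ s t : I01,
      |η1 i j ω s - η1 i j ω t| ≤ M1 ω * |(s : ℝ) - (t : ℝ)| ^ ϑ)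
    (hHold2 : ∀ i j, ∀ᵐ ω ∂P, ∀ s t : I01,
      |η2 i j ω s - η2 i j ω t| ≤ M2 ω * |(s : ℝ) - (t : ℝ)| ^ ϑ)
    -- the variance functions, assumed continuous and strictly positive
    (hσ1cont : Continuous (fun t : I01 => ∫ ω, (η1 0 0 ω t) ^ 2 ∂P))
    (hσ2cont : Continuous (fun t : I01 => ∫ ω, (η2 0 0 ω t) ^ 2 ∂P))
    (hσ1pos : ∀ t : I01, 0 < ∫ ω, (η1 0 0 ω t) ^ 2 ∂P)
    (hσ2pos : ∀ t : I01, 0 < ∫ ω, (η2 0 0 ω t) ^ 2 ∂P)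
    -- sequences `A k → ∞`, `min_{i<A k} n k i → ∞`, `A/√N → 0`
    (A : ℕ → ℕ) (hApos : ∀ k, 0 < A k) (hA : Tendsto A atTop atTop)
    (n : ℕ → ℕ → ℕ) (hnpos : ∀ k i, 0 < n k i)
    (hmin : Tendsto (fun k => (Finset.range (A k)).inf'
      (Finset.nonempty_range_iff.mpr (hApos k).ne') (n k)) atTop atTop)
    (hAN : Tendsto (fun k => (A k : ℝ) /
      Real.sqrt (∑ i ∈ Finset.range (A k), (n k i : ℝ))) atTop (𝓝 0)) :
    ∀ δ > (0:ℝ),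
      Tendsto (fun k => (P {ω | δ < ⨆ t : I01,
        |Real.sqrt (∑ i ∈ Finset.range (A k), (n k i : ℝ)) *
            (Real.log (sigmaHatSq μ1 ε1 η1 (A k) (n k) ω t
                / sigmaHatSq μ2 ε2 η2 (A k) (n k) ω t)
              - Real.log ((∫ ω', (η1 0 0 ω' t) ^ 2 ∂P) / (∫ ω', (η2 0 0 ω' t) ^ 2 ∂P)))
          - (Real.sqrt (∑ i ∈ Finset.range (A k), (n k i : ℝ))
              / ((∑ i ∈ Finset.range (A k), (n k i : ℝ)) - (A k : ℝ))) *
            ∑ i ∈ Finset.range (A k), ∑ j ∈ Finset.range (n k i),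
              (((η1 i j ω t) ^ 2 - ∫ ω', (η1 0 0 ω' t) ^ 2 ∂P)
                  / (∫ ω', (η1 0 0 ω' t) ^ 2 ∂P)
                - ((η2 i j ω t) ^ 2 - ∫ ω', (η2 0 0 ω' t) ^ 2 ∂P)
                  / (∫ ω', (η2 0 0 ω' t) ^ 2 ∂P))|}).toReal)
        atTop (𝓝 0) := by
  intro δ hδ
  have hinj : Function.Injective (fun p : (_ : ℕ) × ℕ => (Sum.inr (p.1, p.2) : ℕ ⊕ ℕ × ℕ)) := by
    rintro ⟨a, b⟩ ⟨c, d⟩ h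
    simp only [Sum.inr.injEq, Prod.mk.injEq] at h
    obtain ⟨rfl, rfl⟩ := h
    rfl
  have hpre := hindep.precomp hinj
  have hind1 : iIndepFun (fun (p : (_ : ℕ) × ℕ) => η1 p.1 p.2) P :=
    hpre.comp (fun _ => Prod.fst) (fun _ => measurable_fst)
  have hind2 : iIndepFun (fun (p : (_ : ℕ) × ℕ) => η2 p.1 p.2) P :=
    hpre.comp (fun _ => Prod.snd) (fun _ => measurable_snd)
  have hpm : ∀ i j, Measurable fun ω => (η1 i j ω, η2 i j ω) := fun i j =>
    (hmeasη i j).1.prodMk (hmeasη i j).2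
  have hid1 : ∀ i j, Measure.map (η1 i j) P = Measure.map (η1 0 0) P := by
    intro i j
    have h := congrArg (Measure.map Prod.fst) (hidη i j)
    rw [Measure.map_map measurable_fst (hpm i j), Measure.map_map measurable_fst (hpm 0 0)] at h
    exact h
  have hid2 : ∀ i j, Measure.map (η2 i j) P = Measure.map (η2 0 0) P := by
    intro i j
    have h := congrArg (Measure.map Prod.snd) (hidη i j)
    rw [Measure.map_map measurable_snd (hpm i j), Measure.map_map measurable_snd (hpm 0 0)] at h
    exact h
  have H1 := onecoord P μ1 ε1 η1 (fun i j => (hmeasη i j).1) hind1 hid1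
    (fun i j t => (hcentη i j t).1) hmom18 ϑ Ktilde hϑ M1 hM10 hM14 hHold1 hσ1cont hσ1pos
    A hA n hnpos hAN (δ / 2) (by positivity)
  have H2 := onecoord P μ2 ε2 η2 (fun i j => (hmeasη i j).2) hind2 hid2
    (fun i j t => (hcentη i j t).2) hmom28 ϑ Ktilde hϑ M2 hM20 hM24 hHold2 hσ2cont hσ2pos
    A hA n hnpos hAN (δ / 2) (by positivity)
  have H3 := H1.add H2
  rw [add_zero] at H3
  have hz := ENNReal.tendsto_toReal ENNReal.zero_ne_top
  rw [ENNReal.toReal_zero] at hz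
  refine hz.comp ?_
  refine tendsto_of_tendsto_of_tendsto_of_le_of_le tendsto_const_nhds H3
    (fun _ => zero_le) (fun k => ?_)
  refine le_trans (measure_mono ?_) (measure_union_le _ _)
  intro ω hω
  by_contra hcon
  simp only [Set.mem_union, Set.mem_ofPred_eq, not_or, not_exists, not_not] at hcon
  obtain ⟨c1, c2⟩ := hcon
  have hω' : δ < _ := hω
  refine absurd hω' (not_lt.2 ?_)
  have : Nonempty I01 := ⟨0⟩
  refine ciSup_le fun t => ?_
  obtain ⟨p1, q1⟩ := c1 t
  obtain ⟨p2, q2⟩ := c2 t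
  have v1 := hσ1pos t
  have v2 := hσ2pos t
  rw [Real.log_div p1.ne' p2.ne', Real.log_div v1.ne' v2.ne']
  have hsplit : ∑ i ∈ Finset.range (A k), ∑ j ∈ Finset.range (n k i),
      (((η1 i j ω t) ^ 2 - ∫ ω', (η1 0 0 ω' t) ^ 2 ∂P) / (∫ ω', (η1 0 0 ω' t) ^ 2 ∂P)
        - ((η2 i j ω t) ^ 2 - ∫ ω', (η2 0 0 ω' t) ^ 2 ∂P) / (∫ ω', (η2 0 0 ω' t) ^ 2 ∂P))
      = (∑ i ∈ Finset.range (A k), ∑ j ∈ Finset.range (n k i),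
      ((η1 i j ω t) ^ 2 - ∫ ω', (η1 0 0 ω' t) ^ 2 ∂P)) / (∫ ω', (η1 0 0 ω' t) ^ 2 ∂P)
      - (∑ i ∈ Finset.range (A k), ∑ j ∈ Finset.range (n k i),
      ((η2 i j ω t) ^ 2 - ∫ ω', (η2 0 0 ω' t) ^ 2 ∂P)) / (∫ ω', (η2 0 0 ω' t) ^ 2 ∂P) := by
    rw [Finset.sum_div, Finset.sum_div, ← Finset.sum_sub_distrib]
    refine Finset.sum_congr rfl fun i _ => ?_
    rw [Finset.sum_div, Finset.sum_div, ← Finset.sum_sub_distrib]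
  rw [hsplit, mul_sub]
  rw [abs_le] at q1 q2 ⊢
  constructor <;> linarith [q1.1, q1.2, q2.1, q2.2]
end
end

section
/- (Directional expansion of the maximum functional) Let f: [0,1] → ℝ be continuous, T = max_{t∈[0,1]} f(t), and E = {t ∈ [0,1] : f(t) = T} (which is nonempty and compact). Let (ε_n) ⊂ (0,∞) with ε_n → 0, and let (h_n) be a sequence of continuous functions on [0,1] that is uniformly bounded (sup_n ‖h_n‖∞ ≤ B < ∞) and uniformly equicontinuous. Then (1/ε_n)·( max_{t∈[0,1]} ( f(t) + ε_n·h_n(t) ) − T ) − max_{t∈E} h_n(t) → 0 as n → ∞. -/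
open Filter Topology

noncomputable section

/-- **Directional expansion of the maximum functional.**
Let `f` be continuous on `[0,1]` with maximum `T = ⨆ t, f t` attained on the extremal set
`E = {t | f t = T}`. If `ε_n → 0` with `ε_n > 0` and `(h_n)` is a uniformly bounded,
uniformly equicontinuous sequence of continuous functions, then
`(1/ε_n)·(max_t (f + ε_n h_n) − T) − max_{t ∈ E} h_n(t) → 0`. -/
theorem statement15 (f : I01 → ℝ) (hf : Continuous f)
    (h : ℕ → I01 → ℝ) (hhc : ∀ n, Continuous (h n))
    (B : ℝ) (hB : ∀ n t, |h n t| ≤ B)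
    (hequi : ∀ δ > 0, ∃ γ > 0, ∀ n (s t : I01),
      |(s : ℝ) - (t : ℝ)| ≤ γ → |h n s - h n t| ≤ δ)
    (ε : ℕ → ℝ) (hεpos : ∀ n, 0 < ε n) (hε : Tendsto ε atTop (𝓝 0)) :
    Tendsto (fun n =>
      (1 / ε n) * ((⨆ t : I01, (f t + ε n * h n t)) - (⨆ t : I01, f t))
        - sSup (h n '' {t : I01 | f t = ⨆ s : I01, f s})) atTop (𝓝 0) := by
  obtain ⟨t₀, ht₀⟩ : ∃ t₀ : I01, ∀ t, f t ≤ f t₀ := by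
    obtain ⟨x, -, hx⟩ := isCompact_univ.exists_isMaxOn (Set.univ_nonempty (α := I01)) hf.continuousOn
    exact ⟨x, fun t => hx (Set.mem_univ t)⟩
  have hT : (⨆ t : I01, f t) = f t₀ :=
    le_antisymm (ciSup_le ht₀) (le_ciSup ⟨f t₀, by rintro _ ⟨t, rfl⟩; exact ht₀ t⟩ t₀)
  rw [hT]
  set T := f t₀ with hTdef
  have hbddE : ∀ n, BddAbove (h n '' {t : I01 | f t = T}) := fun n =>
    ⟨B, by rintro _ ⟨t, -, rfl⟩; exact (abs_le.mp (hB n t)).2⟩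
  have hleM : ∀ n s, f s = T → h n s ≤ sSup (h n '' {t : I01 | f t = T}) := fun n s hs =>
    le_csSup (hbddE n) ⟨s, hs, rfl⟩
  have hbdd : ∀ n, BddAbove (Set.range fun t : I01 => f t + ε n * h n t) := fun n =>
    ⟨T + ε n * B, by
      rintro _ ⟨t, rfl⟩
      exact add_le_add (ht₀ t) (mul_le_mul_of_nonneg_left (abs_le.mp (hB n t)).2 (hεpos n).le)⟩
  rw [Metric.tendsto_atTop]
  intro δ' hδ'
  obtain ⟨γ, hγ, hγ'⟩ := hequi (δ' / 2) (by positivity)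
  obtain ⟨η, hη, hη'⟩ : ∃ η > 0, ∀ t : I01, T - η < f t → ∃ s, f s = T ∧ dist t s ≤ γ := by
    have hK : IsClosed {t : I01 | ∀ s, f s = T → γ ≤ dist t s} := by
      simp only [Set.setOf_forall]
      refine isClosed_iInter fun s => isClosed_iInter fun _ => ?_
      exact isClosed_le continuous_const (by fun_prop)
    rcases Set.eq_empty_or_nonempty {t : I01 | ∀ s, f s = T → γ ≤ dist t s} with he | hne
    · refine ⟨1, one_pos, fun t _ => ?_⟩
      by_contra! hc
      have : t ∈ {t : I01 | ∀ s, f s = T → γ ≤ dist t s} := fun s hs => (hc s hs).le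
      rw [he] at this
      exact this
    · obtain ⟨x, hxK, hx⟩ := hK.isCompact.exists_isMaxOn hne hf.continuousOn
      have hxT : f x < T := by
        refine lt_of_le_of_ne (ht₀ x) fun hc => ?_
        have := hxK x hc
        rw [dist_self] at this
        linarith
      refine ⟨T - f x, by linarith, fun t ht => ?_⟩
      by_contra! hc
      have : f t ≤ f x := hx (show t ∈ _ from fun s hs => (hc s hs).le)
      linarith
  have hev : ∀ᶠ n in atTop, ε n * (2 * B) < η := by
    have : Tendsto (fun n => ε n * (2 * B)) atTop (𝓝 0) := by
      simpa using hε.mul_const (2 * B)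
    exact this.eventually_lt_const hη
  obtain ⟨N, hN⟩ := eventually_atTop.mp hev
  refine ⟨N, fun n hn => ?_⟩
  have hεn := hεpos n
  have hNn := hN n hn
  have hM0 := hleM n t₀ rfl
  have hB0 := (abs_le.mp (hB n t₀)).1
  have hlow : sSup (h n '' {t : I01 | f t = T}) ≤
      (1 / ε n) * ((⨆ t : I01, (f t + ε n * h n t)) - T) := by
    refine csSup_le ⟨_, t₀, rfl, rfl⟩ ?_
    rintro _ ⟨s, hs, rfl⟩
    have h1 := le_ciSup (hbdd n) s
    have hs' : f s = T := hs
    simp only [hs'] at h1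
    rw [one_div_mul_eq_div, le_div_iff₀ hεn]
    linarith
  have hup : (1 / ε n) * ((⨆ t : I01, (f t + ε n * h n t)) - T) ≤
      sSup (h n '' {t : I01 | f t = T}) + δ' / 2 := by
    rw [one_div_mul_eq_div, div_le_iff₀ hεn, sub_le_iff_le_add]
    refine ciSup_le fun t => ?_
    set M := sSup (h n '' {t : I01 | f t = T}) with hMdef
    by_cases ht : T - η < f t
    · obtain ⟨s, hs, hd⟩ := hη' t ht
      have h1 := (abs_le.mp (hγ' n t s hd)).2
      have h2 := hleM n s hs
      have h3 : ε n * h n t ≤ ε n * (M + δ' / 2) :=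
        mul_le_mul_of_nonneg_left (by linarith) hεn.le
      have := ht₀ t
      linarith
    · have h1 := (abs_le.mp (hB n t)).2
      have h3 : ε n * h n t ≤ ε n * B := mul_le_mul_of_nonneg_left h1 hεn.le
      have h4 : ε n * (-B) ≤ ε n * (M + δ' / 2) :=
        mul_le_mul_of_nonneg_left (by linarith) hεn.le
      linarith
  rw [Real.dist_eq, sub_zero, abs_lt]
  constructor <;> linarith
end
end
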